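/- Suppose π and π′ are grounded patterns of length k that are strongly c-forest-Wilf equivalent. Then π and π′ have the same streak, and for every value i ∈ {2,…,k} the height of i in π equals the height of i in π′. -/

import Mathlib

/-- A rooted labeled forest on `[n]`: vertices are identified with their labels in `Fin n`
(`i : Fin n` representing the label `i+1`), each vertex has an optional parent, and the
parent relation is acyclic. Components are rooted at the vertices with no parent, and
children are unordered since only the parent function is recorded. -/
structure RForest (n : ℕ) where
  parent : Fin n → Option (Fin n)
  acyclic : ∀ v : Fin n, ¬ Relation.TransGen (fun a b => parent b = some a) v v

namespace RForest

variable {n : ℕ}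

/-- `u` is a strict ancestor of `v`. -/
def SAnc (F : RForest n) (u v : Fin n) : Prop :=
  Relation.TransGen (fun a b => F.parent b = some a) u v

/-- `u` is an ancestor of `v` (possibly `u = v`). -/
def Anc (F : RForest n) (u v : Fin n) : Prop :=
  F.SAnc u v ∨ u = v

/-- `F` is a tree: it has exactly one root, i.e. exactly one component. -/
def IsTree (F : RForest n) : Prop :=
  ∃! r : Fin n, F.parent r = none

end RForest

/-- A pattern of length `k` is a permutation of `[k]` (presented 0-indexed on `Fin k`). -/
abbrev Pattern (k : ℕ) := Equiv.Perm (Fin k)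

/-- The complement of a pattern: `π̄(i) = k + 1 - π(i)` in 1-indexed terms. -/
def Pattern.compl {k : ℕ} (π : Pattern k) : Pattern k :=
  π.trans ⟨Fin.rev, Fin.rev, Fin.rev_rev, Fin.rev_rev⟩

/-- `F` contains a (classical) instance of the pattern `π`: vertices `v 0, …, v (k-1)`,
each a strict ancestor of the next, whose labels are in the same relative order as `π`. -/
def ContainsPat {n k : ℕ} (F : RForest n) (π : Pattern k) : Prop :=
  ∃ v : Fin k → Fin n,
    (∀ i j : Fin k, i < j → F.SAnc (v i) (v j)) ∧
    (∀ i j : Fin k, v i < v j ↔ π i < π j)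

/-- `v` is a consecutive instance of `π` in `F`: a downward path (each vertex the parent of
the next) whose labels are in the same relative order as `π`. -/
def IsConsInstance {n k : ℕ} (F : RForest n) (π : Pattern k) (v : Fin k → Fin n) : Prop :=
  (∀ i j : Fin k, (j : ℕ) = (i : ℕ) + 1 → F.parent (v j) = some (v i)) ∧
  (∀ i j : Fin k, v i < v j ↔ π i < π j)

/-- `F` contains a consecutive instance of `π`. -/
def CContainsPat {n k : ℕ} (F : RForest n) (π : Pattern k) : Prop :=
  ∃ v, IsConsInstance F π v

/-- `F` avoids every pattern in the set `S` (of patterns of arbitrary lengths). -/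
def AvoidsSet {n : ℕ} (F : RForest n) (S : Set ((k : ℕ) × Pattern k)) : Prop :=
  ∀ p ∈ S, ¬ ContainsPat F p.2

/-- `f_n(S)`: the number of rooted labeled forests on `[n]` avoiding `S`. -/
noncomputable def fCount (S : Set ((k : ℕ) × Pattern k)) (n : ℕ) : ℕ :=
  Nat.card {F : RForest n // AvoidsSet F S}

/-- `t_n(S)`: the number of rooted labeled trees on `[n]` avoiding `S`. -/
noncomputable def tCount (S : Set ((k : ℕ) × Pattern k)) (n : ℕ) : ℕ :=
  Nat.card {F : RForest n // F.IsTree ∧ AvoidsSet F S}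

/-- The number of rooted labeled forests on `[n]` consecutively avoiding `π`. -/
noncomputable def cCount {k : ℕ} (π : Pattern k) (n : ℕ) : ℕ :=
  Nat.card {F : RForest n // ¬ CContainsPat F π}

/-- c-forest-Wilf equivalence of two patterns. -/
def CForestWilfEquiv {k k' : ℕ} (π : Pattern k) (π' : Pattern k') : Prop :=
  ∀ n : ℕ, cCount π n = cCount π' n

def p123 : Pattern 3 := 1
def p132 : Pattern 3 := ⟨![0, 2, 1], ![0, 2, 1], by intro x; fin_cases x <;> rfl, by intro x; fin_cases x <;> rfl⟩
def p213 : Pattern 3 := ⟨![1, 0, 2], ![1, 0, 2], by intro x; fin_cases x <;> rfl, by intro x; fin_cases x <;> rfl⟩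
def p231 : Pattern 3 := ⟨![1, 2, 0], ![2, 0, 1], by intro x; fin_cases x <;> rfl, by intro x; fin_cases x <;> rfl⟩
def p312 : Pattern 3 := ⟨![2, 0, 1], ![1, 2, 0], by intro x; fin_cases x <;> rfl, by intro x; fin_cases x <;> rfl⟩
def p321 : Pattern 3 := ⟨![2, 1, 0], ![2, 1, 0], by intro x; fin_cases x <;> rfl, by intro x; fin_cases x <;> rfl⟩
def p2413 : Pattern 4 := ⟨![1, 3, 0, 2], ![2, 0, 3, 1], by intro x; fin_cases x <;> rfl, by intro x; fin_cases x <;> rfl⟩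
def p2314 : Pattern 4 := ⟨![1, 2, 0, 3], ![2, 0, 1, 3], by intro x; fin_cases x <;> rfl, by intro x; fin_cases x <;> rfl⟩
def p3142 : Pattern 4 := ⟨![2, 0, 3, 1], ![1, 3, 0, 2], by intro x; fin_cases x <;> rfl, by intro x; fin_cases x <;> rfl⟩
def p3124 : Pattern 4 := ⟨![2, 0, 1, 3], ![1, 2, 0, 3], by intro x; fin_cases x <;> rfl, by intro x; fin_cases x <;> rfl⟩

/-- The streak of `π`: the largest `m ≤ k` such that `π(i) = i` for all `1 ≤ i ≤ m`
(0-indexed: `π i = i` for all `i < m`). -/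
noncomputable def streak {k : ℕ} (π : Pattern k) : ℕ :=
  sSup {m | m ≤ k ∧ ∀ i : Fin k, (i : ℕ) < m → (π i : ℕ) = (i : ℕ)}

/-- The height of the entry at (0-indexed) position `t` of `π`: the largest `m ≤ t` such
that the `m` consecutive entries of `π` ending at position `t` are increasing. -/
noncomputable def heightAt {k : ℕ} (π : Pattern k) (t : Fin k) : ℕ :=
  sSup {m | m ≤ (t : ℕ) ∧ ∀ a b : Fin k, (t : ℕ) < (a : ℕ) + m →
    (b : ℕ) = (a : ℕ) + 1 → (b : ℕ) ≤ (t : ℕ) → π a < π b}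

/-- The max height of `π`: the maximum of the heights over all non-initial positions. -/
noncomputable def maxHeight {k : ℕ} (π : Pattern k) : ℕ :=
  sSup {h | ∃ t : Fin k, 0 < (t : ℕ) ∧ h = heightAt π t}

/-- A pattern is grounded if it is not the identity and its max height is at most its
streak. -/
def Grounded {k : ℕ} (π : Pattern k) : Prop :=
  π ≠ 1 ∧ maxHeight π ≤ streak π

/-- The number of rooted labeled forests on `[n]` with exactly `m` consecutive
instances of `π`. -/
noncomputable def strongCount {k : ℕ} (π : Pattern k) (n m : ℕ) : ℕ :=
  Nat.card {F : RForest n // Nat.card {v : Fin k → Fin n // IsConsInstance F π v} = m}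

/-- Strong c-forest-Wilf equivalence: for all `m, n`, the number of forests on `[n]`
with exactly `m` consecutive instances of `π` equals that for `π'`. -/
def StrongCEquiv {k : ℕ} (π π' : Pattern k) : Prop :=
  ∀ m n : ℕ, strongCount π n m = strongCount π' n m

section

open Finset
open scoped Classical

namespace RForest

variable {n k : ℕ}

theorem parent_injective : Function.Injective (RForest.parent (n := n)) := by
  rintro ⟨p, _⟩ ⟨q, _⟩ (rfl : p = q)
  rfl

noncomputable instance : Fintype (RForest n) :=
  have := Finite.of_injective _ (parent_injective (n := n))
  Fintype.ofFinite _

/-- Consecutive vertices of `v` are parent and child in `F`. -/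
def IsPath (F : RForest n) (v : Fin k → Fin n) : Prop :=
  ∀ i j : Fin k, (j : ℕ) = (i : ℕ) + 1 → F.parent (v j) = some (v i)

/-- The number of strict ancestors of a vertex. -/
noncomputable def depth (F : RForest n) (x : Fin n) : ℕ := #(univ.filter fun a => F.SAnc a x)

theorem depth_child (F : RForest n) {x y : Fin n} (h : F.parent x = some y) :
    F.depth x = F.depth y + 1 := by
  have key : univ.filter (fun a => F.SAnc a x) = insert y (univ.filter fun a => F.SAnc a y) := by
    ext a
    simp only [mem_filter, mem_univ, true_and, mem_insert]
    constructor
    · intro ha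
      obtain ⟨b, hab, hb⟩ := Relation.TransGen.tail'_iff.1 ha
      have : b = y := by
        rw [h] at hb
        exact (Option.some.inj hb).symm
      subst this
      rcases Relation.reflTransGen_iff_eq_or_transGen.1 hab with h1 | h1
      · exact Or.inl h1.symm
      · exact Or.inr h1
    · rintro (rfl | ha)
      · exact Relation.TransGen.single h
      · exact Relation.TransGen.tail ha h
  rw [depth, key, card_insert_of_notMem]
  · rfl
  · exact fun h => F.acyclic y (mem_filter.1 h).2

theorem IsPath.depth_eq {F : RForest n} {v : Fin k → Fin n} (hv : F.IsPath v) (o : Fin k)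
    (ho : (o : ℕ) = 0) (i : Fin k) : F.depth (v i) = F.depth (v o) + i := by
  obtain ⟨i, hi⟩ := i
  induction i with
  | zero =>
    have : o = ⟨0, hi⟩ := Fin.ext ho
    simp [this]
  | succ i ih =>
    rw [F.depth_child (hv ⟨i, by omega⟩ ⟨i + 1, hi⟩ rfl), ih]
    rfl

theorem IsPath.reflTransGen {F : RForest n} {v : Fin k → Fin n} (hv : F.IsPath v) (o : Fin k)
    (ho : (o : ℕ) = 0) (i : Fin k) :
    Relation.ReflTransGen (fun a b => F.parent b = some a) (v o) (v i) := by
  obtain ⟨i, hi⟩ := i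
  induction i with
  | zero =>
    have : o = ⟨0, hi⟩ := Fin.ext ho
    simp [this, Relation.ReflTransGen.refl]
  | succ i ih =>
    exact (ih (by omega)).tail (hv ⟨i, by omega⟩ ⟨i + 1, hi⟩ rfl)

/-- A parent relation that is functional and increases some depth function is realised by a
forest. -/
theorem exists_of_rel (R : Fin n → Fin n → Prop) (D : Fin n → ℕ)
    (hR : ∀ x y z, R x z → R y z → x = y) (hD : ∀ x y, R x y → D x < D y) :
    ∃ F : RForest n, ∀ x y, R x y → F.parent y = some x := by
  let p : Fin n → Option (Fin n) := fun y => if h : ∃ x, R x y then some h.choose else none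
  have hp : ∀ a b, p b = some a → R a b := by
    intro a b hab
    simp only [p] at hab
    split_ifs at hab with h
    exact Option.some.inj hab ▸ h.choose_spec
  refine ⟨⟨p, fun v hv => ?_⟩, fun x y h => ?_⟩
  · have key : ∀ a b, Relation.TransGen (fun a b => p b = some a) a b → D a < D b := by
      intro a b h
      induction h with
      | single h => exact hD _ _ (hp _ _ h)
      | tail _ h ih => exact ih.trans (hD _ _ (hp _ _ h))
    exact lt_irrefl _ (key v v hv)
  · have h' : ∃ x, R x y := ⟨x, h⟩
    simp only [p, dif_pos h']
    rw [hR _ _ _ h h'.choose_spec]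

/-- `F` restricts to a tree on `U` with root `r`. -/
structure TreeOn (F : RForest n) (U : Finset (Fin n)) (r : Fin n) : Prop where
  root_mem : r ∈ U
  parent_mem : ∀ x ∈ U, x ≠ r → ∃ y ∈ U, F.parent x = some y
  reach : ∀ x ∈ U, Relation.ReflTransGen (fun a b => F.parent b = some a) r x

theorem TreeOn.parent_root {F : RForest n} {U : Finset (Fin n)} {r y : Fin n}
    (h : F.TreeOn U r) (hy : y ∈ U) : F.parent r ≠ some y := fun hr =>
  F.acyclic r (Relation.TransGen.tail' (h.reach y hy) hr)

/-- The tree that a forest `F` induces on `U` may be replaced by any other tree on `U`. -/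
theorem TreeOn.exists_swap {F G : RForest n} {U : Finset (Fin n)} {r s : Fin n}
    (hF : F.TreeOn U r) (hG : G.TreeOn U s) :
    ∃ H : RForest n, (∀ x ∉ U, H.parent x = F.parent x) ∧ H.parent s = F.parent r ∧
      ∀ x ∈ U, x ≠ s → H.parent x = G.parent x := by
  let p : Fin n → Option (Fin n) := fun x =>
    if x ∉ U then F.parent x else if x = s then F.parent r else G.parent x
  have p1 : ∀ x ∉ U, p x = F.parent x := fun x hx => by simp [p, hx]
  have p2 : p s = F.parent r := by simp [p, hG.root_mem]
  have p3 : ∀ x ∈ U, x ≠ s → p x = G.parent x := fun x hx hs => by simp [p, hx, hs]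
  have out : ∀ a b, Relation.TransGen (fun a b => p b = some a) a b → b ∉ U →
      Relation.TransGen (fun a b => F.parent b = some a) (if a ∈ U then r else a) b := by
    intro a b hab hb
    induction hab using Relation.TransGen.head_induction_on with
    | single h =>
      rename_i a
      rw [p1 b hb] at h
      split_ifs with ha
      · exact Relation.TransGen.tail' (hF.reach a ha) h
      · exact Relation.TransGen.single h
    | head h hcb ih =>
      rename_i a c
      by_cases hc : c ∈ U
      · rw [if_pos hc] at ih
        split_ifs with ha
        · exact ih
        · by_cases hcs : c = s
          · subst hcs
            rw [p2] at h
            exact Relation.TransGen.head h ih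
          · obtain ⟨y, hy, hy'⟩ := hG.parent_mem c hc hcs
            rw [p3 c hc hcs, hy'] at h
            exact absurd (Option.some.inj h ▸ hy) ha
      · rw [if_neg hc] at ih
        rw [p1 c hc] at h
        split_ifs with ha
        · exact (Relation.TransGen.tail' (hF.reach a ha) h).trans ih
        · exact Relation.TransGen.head h ih
  have out' : ∀ c ∉ U, ¬ Relation.TransGen (fun a b => p b = some a) c c := by
    intro c hc h
    have := out c c h hc
    rw [if_neg hc] at this
    exact F.acyclic c this
  have inside : ∀ a b, Relation.TransGen (fun a b => p b = some a) a b → a ∈ U → b ∈ U →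
      Relation.TransGen (fun a b => G.parent b = some a) a b ∨
      ∃ c ∉ U, Relation.TransGen (fun a b => p b = some a) a c ∧
        Relation.TransGen (fun a b => p b = some a) c b := by
    have edge : ∀ a b, a ∈ U → b ∈ U → p b = some a → G.parent b = some a := by
      intro a b ha hb h
      have hbs : b ≠ s := by
        rintro rfl
        rw [p2] at h
        exact hF.parent_root ha h
      rwa [p3 b hb hbs] at h
    intro a b hab ha
    induction hab with
    | single h => exact fun hb => Or.inl (Relation.TransGen.single (edge _ _ ha hb h))
    | tail hac h ih =>
      rename_i c b
      intro hb
      by_cases hc : c ∈ U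
      · rcases ih hc with h1 | ⟨d, hd, h1, h2⟩
        · exact Or.inl (h1.tail (edge _ _ hc hb h))
        · exact Or.inr ⟨d, hd, h1, h2.tail h⟩
      · exact Or.inr ⟨c, hc, hac, Relation.TransGen.single h⟩
  refine ⟨⟨p, fun v hv => ?_⟩, p1, p2, p3⟩
  by_cases hvU : v ∈ U
  · rcases inside v v hv hvU hvU with h | ⟨c, hc, h1, h2⟩
    · exact G.acyclic v h
    · exact out' c hc (h2.trans h1)
  · exact out' v hvU hv

/-- The forest obtained by renaming the vertices of `F` along a permutation. -/
def permute (F : RForest n) (τ : Equiv.Perm (Fin n)) : RForest n where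
  parent x := (F.parent (τ.symm x)).map τ
  acyclic v hv := by
    refine F.acyclic (τ.symm v) (hv.lift τ.symm fun a b h => ?_)
    obtain ⟨c, hc, rfl⟩ := Option.map_eq_some_iff.1 h
    simpa [Function.onFun] using hc

theorem permute_injective (τ : Equiv.Perm (Fin n)) :
    Function.Injective fun F : RForest n => F.permute τ := by
  intro F G h
  apply parent_injective
  funext x
  have := congrFun (congrArg parent h) (τ x)
  simp only [permute, Equiv.symm_apply_apply] at this
  exact Option.map_injective τ.injective this

theorem IsPath.permute {F : RForest n} {v : Fin k → Fin n} (hv : F.IsPath v)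
    (τ : Equiv.Perm (Fin n)) : (F.permute τ).IsPath (τ ∘ v) := by
  intro i j hij
  simp [RForest.permute, hv i j hij]

end RForest

section Pairs

variable {n k : ℕ}

/-- The path `w` starts on `v`, and exactly the first `l` entries of `w` lie on `v`, the last of
them at position `t`. -/
def Attached (v w : Fin k → Fin n) (t : Fin k) (l : ℕ) : Prop :=
  1 ≤ l ∧ l ≤ t + 1 ∧ ∀ i j : Fin k, v i = w j ↔ (i : ℕ) + l = t + 1 + j ∧ (j : ℕ) < l

/-- One of the two paths starts on the other one. -/
def Linked (v w : Fin k → Fin n) : Prop :=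
  (∃ t l, Attached v w t l) ∨ ∃ t l, Attached w v t l

/-- The vertices of the two paths. -/
noncomputable def support (v w : Fin k → Fin n) : Finset (Fin n) := univ.image v ∪ univ.image w

/-- The number of forests in which both `v` and `w` are downward paths. -/
noncomputable def numExt (v w : Fin k → Fin n) : ℕ :=
  #(univ.filter fun F : RForest n => F.IsPath v ∧ F.IsPath w)

theorem mem_support {v w : Fin k → Fin n} {x : Fin n} :
    x ∈ support v w ↔ (∃ i, v i = x) ∨ ∃ i, w i = x := by
  simp [support]

theorem support_comm (v w : Fin k → Fin n) : support v w = support w v := union_comm _ _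

theorem Attached.exists_eq {v w : Fin k → Fin n} {t : Fin k} {l : ℕ} (h : Attached v w t l)
    (j : Fin k) (hj : (j : ℕ) < l) : ∃ i : Fin k, (i : ℕ) + l = t + 1 + j ∧ v i = w j := by
  have h2 := h.2.1
  have ht := t.2
  exact ⟨⟨t + 1 + j - l, by omega⟩, by simp only; omega, (h.2.2 _ _).2 ⟨by simp only; omega, hj⟩⟩

theorem Attached.exists_forest {v w : Fin k → Fin n} {t : Fin k} {l : ℕ}
    (h : Attached v w t l) (hv : Function.Injective v) (hw : Function.Injective w) :
    ∃ F : RForest n, F.IsPath v ∧ F.IsPath w := by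
  let D : Fin n → ℕ := fun x =>
    if h : ∃ i, v i = x then (h.choose : ℕ) else
      if h : ∃ j, w j = x then t + 1 + h.choose - l else 0
  have Dv : ∀ i, D (v i) = i := by
    intro i
    have hi : ∃ i', v i' = v i := ⟨i, rfl⟩
    simp only [D, dif_pos hi]
    rw [hv hi.choose_spec]
  have Dw : ∀ j, D (w j) + l = t + 1 + j := by
    intro j
    by_cases hj : ∃ i, v i = w j
    · obtain ⟨i, hi⟩ := hj
      rw [← hi, Dv]
      exact ((h.2.2 _ _).1 hi).1
    · have hj' : ∃ j', w j' = w j := ⟨j, rfl⟩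
      simp only [D, dif_neg hj, dif_pos hj']
      rw [hw hj'.choose_spec]
      have := h.2.1
      omega
  obtain ⟨F, hF⟩ := RForest.exists_of_rel
    (fun y x => ∃ i j : Fin k, (j : ℕ) = i + 1 ∧ (v j = x ∧ v i = y ∨ w j = x ∧ w i = y)) D
    (by
      have mixed : ∀ i j i' j' : Fin k, (j : ℕ) = i + 1 → (j' : ℕ) = i' + 1 → v j = w j' →
          v i = w i' := by
        intro i j i' j' hj hj' e
        rw [h.2.2] at e ⊢
        omega
      rintro x y z ⟨i, j, hij, ⟨rfl, rfl⟩ | ⟨rfl, rfl⟩⟩ ⟨i', j', hij', ⟨e, rfl⟩ | ⟨e, rfl⟩⟩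
      · have := hv e
        rw [show i = i' from Fin.ext (by subst this; omega)]
      · exact mixed _ _ _ _ hij hij' e.symm
      · exact (mixed _ _ _ _ hij' hij e).symm
      · have := hw e
        rw [show i = i' from Fin.ext (by subst this; omega)])
    (by
      rintro y x ⟨i, j, hij, ⟨rfl, rfl⟩ | ⟨rfl, rfl⟩⟩
      · rw [Dv, Dv]
        omega
      · have h1 := Dw i
        have h2 := Dw j
        omega)
  exact ⟨F, fun i j hij => hF _ _ ⟨i, j, hij, Or.inl ⟨rfl, rfl⟩⟩,
    fun i j hij => hF _ _ ⟨i, j, hij, Or.inr ⟨rfl, rfl⟩⟩⟩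

theorem RForest.IsPath.attached {F : RForest n} {v w : Fin k → Fin n} (hv : F.IsPath v)
    (hw : F.IsPath w) {i₀ j₀ : Fin k} (h : v i₀ = w j₀) (hij : j₀ ≤ i₀) :
    ∃ t l, Attached v w t l := by
  have k0 : 0 < k := i₀.pos
  have depth_add : ∀ i j : Fin k, v i = w j → (i : ℕ) + j₀ = i₀ + j := by
    intro i j e
    have h1 := congrArg F.depth h
    have h2 := congrArg F.depth e
    rw [hv.depth_eq ⟨0, k0⟩ rfl, hw.depth_eq ⟨0, k0⟩ rfl] at h1 h2
    omega
  have up : ∀ i j i' j' : Fin k, (i' : ℕ) = i + 1 → (j' : ℕ) = j + 1 → v i' = w j' →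
      v i = w j := by
    intro i j i' j' hi hj e
    have h1 := hv i i' hi
    rw [e, hw j j' hj] at h1
    exact (Option.some.inj h1).symm
  have hle : (j₀ : ℕ) ≤ i₀ := hij
  let meets : ℕ → Prop := fun j =>
    ∃ i j' : Fin k, (i : ℕ) + j₀ = i₀ + j ∧ (j' : ℕ) = j ∧ v i = w j'
  have meets_pred : ∀ j, meets (j + 1) → meets j := by
    rintro j ⟨i, j', hi, hj, e⟩
    have hi' := i.2
    have hj' := j'.2
    exact ⟨⟨i - 1, by omega⟩, ⟨j, by omega⟩, by simp only; omega, rfl,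
      up _ _ i j' (by simp only; omega) hj e⟩
  have meets_le : ∀ d j, meets (j + d) → meets j := by
    intro d
    induction d with
    | zero => exact fun j h => h
    | succ d ih => exact fun j h => ih j (meets_pred _ h)
  have hex : ∃ j, ¬ meets j := ⟨k, by
    rintro ⟨_, j', _, hj, _⟩
    have := j'.2
    omega⟩
  set l := Nat.find hex with hl
  have hlt : ∀ j, j < l ↔ meets j := by
    intro j
    constructor
    · intro hj
      exact not_not.1 (Nat.find_min hex hj)
    · intro hj
      by_contra hcon
      obtain ⟨d, hd⟩ := Nat.exists_eq_add_of_le (not_lt.1 hcon)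
      exact Nat.find_spec hex (meets_le d l (hd ▸ hj))
  have l1 : 1 ≤ l := by
    have : (j₀ : ℕ) < l := (hlt _).2 ⟨i₀, j₀, rfl, rfl, h⟩
    omega
  obtain ⟨t, j', ht, hj', -⟩ := (hlt (l - 1)).1 (by omega)
  refine ⟨t, l, l1, by omega, fun i j => ⟨fun e => ?_, fun ⟨e1, e2⟩ => ?_⟩⟩
  · have h1 := depth_add i j e
    exact ⟨by omega, (hlt _).2 ⟨i, j, h1, rfl, e⟩⟩
  · obtain ⟨i', j', h1, h2, h3⟩ := (hlt _).1 e2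
    rwa [show i = i' from Fin.ext (by omega), show j = j' from Fin.ext h2.symm]

theorem Attached.treeOn {F : RForest n} {v w : Fin k → Fin n} {t : Fin k} {l : ℕ}
    (h : Attached v w t l) (hv : F.IsPath v) (hw : F.IsPath w) :
    ∃ r, F.TreeOn (support v w) r := by
  have k0 : 0 < k := t.pos
  obtain ⟨i₁, hi₁, e₁⟩ := h.exists_eq ⟨0, k0⟩ h.1
  refine ⟨v ⟨0, k0⟩, mem_support.2 (Or.inl ⟨_, rfl⟩), fun x hx hxr => ?_, fun x hx => ?_⟩
  · have onv : ∀ i, v i ≠ v ⟨0, k0⟩ → ∃ y ∈ support v w, F.parent (v i) = some y := by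
      intro i hi
      have : (i : ℕ) ≠ 0 := fun h0 => hi (congrArg v (Fin.ext h0))
      have hi' := i.2
      exact ⟨v ⟨i - 1, by omega⟩, mem_support.2 (Or.inl ⟨_, rfl⟩),
        hv _ _ (by simp only; omega)⟩
    rcases mem_support.1 hx with ⟨i, rfl⟩ | ⟨j, rfl⟩
    · exact onv i hxr
    · by_cases hj : (j : ℕ) = 0
      · rw [show j = ⟨0, k0⟩ from Fin.ext hj, ← e₁] at hxr ⊢
        exact onv _ hxr
      · have hj' := j.2
        exact ⟨w ⟨j - 1, by omega⟩, mem_support.2 (Or.inr ⟨_, rfl⟩),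
          hw _ _ (by simp only; omega)⟩
  · rcases mem_support.1 hx with ⟨i, rfl⟩ | ⟨j, rfl⟩
    · exact hv.reflTransGen _ rfl i
    · exact (hv.reflTransGen ⟨0, k0⟩ rfl i₁).trans (e₁ ▸ hw.reflTransGen ⟨0, k0⟩ rfl j)

theorem Linked.treeOn {F : RForest n} {v w : Fin k → Fin n} (h : Linked v w)
    (hv : F.IsPath v) (hw : F.IsPath w) : ∃ r, F.TreeOn (support v w) r := by
  rcases h with ⟨t, l, h⟩ | ⟨t, l, h⟩
  · exact h.treeOn hv hw
  · rw [support_comm]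
    exact h.treeOn hw hv

theorem Linked.numExt_pos {v w : Fin k → Fin n} (h : Linked v w) (hv : Function.Injective v)
    (hw : Function.Injective w) : 0 < numExt v w := by
  rcases h with ⟨t, l, h⟩ | ⟨t, l, h⟩
  · obtain ⟨F, hF⟩ := h.exists_forest hv hw
    exact card_pos.2 ⟨F, by simpa using hF⟩
  · obtain ⟨F, hF⟩ := h.exists_forest hw hv
    exact card_pos.2 ⟨F, by simpa using hF.symm⟩

theorem linked_of_numExt_ne_zero {v w : Fin k → Fin n} (h : numExt v w ≠ 0)
    (hd : ¬ ∀ i j, v i ≠ w j) : Linked v w := by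
  obtain ⟨F, hF⟩ := card_pos.1 (Nat.pos_of_ne_zero h)
  obtain ⟨hv, hw⟩ := (mem_filter.1 hF).2
  push Not at hd
  obtain ⟨i, j, e⟩ := hd
  rcases le_total j i with hij | hij
  · exact Or.inl (hv.attached hw e hij)
  · exact Or.inr (hw.attached hv e.symm hij)

theorem Linked.not_disjoint {v w : Fin k → Fin n} (h : Linked v w) : ¬ ∀ i j, v i ≠ w j := by
  rcases h with ⟨t, l, h⟩ | ⟨t, l, h⟩
  · obtain ⟨i, -, e⟩ := h.exists_eq ⟨0, t.pos⟩ h.1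
    exact fun hd => hd _ _ e
  · obtain ⟨i, -, e⟩ := h.exists_eq ⟨0, t.pos⟩ h.1
    exact fun hd => hd _ _ e.symm

/-- Two forests in which a path `v` is present agree on the parents of the entries of `v`
other than the first. -/
theorem RForest.IsPath.eq_zero_or_parent_eq {F G : RForest n} {v : Fin k → Fin n}
    (hF : F.IsPath v) (hG : G.IsPath v) (i : Fin k) :
    (i : ℕ) = 0 ∨ ∃ j, F.parent (v i) = some (v j) ∧ G.parent (v i) = some (v j) := by
  rcases Nat.eq_zero_or_pos (i : ℕ) with h | h
  · exact Or.inl h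
  · have hi := i.2
    exact Or.inr ⟨⟨i - 1, by omega⟩, hF _ _ (by simp only; omega), hG _ _ (by simp only; omega)⟩

theorem Attached.parent_eq {F G : RForest n} {v w : Fin k → Fin n} {t : Fin k} {l : ℕ}
    (h : Attached v w t l) (hFv : F.IsPath v) (hFw : F.IsPath w) (hGv : G.IsPath v)
    (hGw : G.IsPath w) {r : Fin n} (hr : F.TreeOn (support v w) r) {x : Fin n}
    (hx : x ∈ support v w) (hxr : x ≠ r) : F.parent x = G.parent x := by
  have k0 : 0 < k := t.pos
  obtain ⟨i₁, hi₁, e₁⟩ := h.exists_eq ⟨0, k0⟩ h.1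
  have v0 : v ⟨0, k0⟩ = r := by
    rcases Relation.reflTransGen_iff_eq_or_transGen.1
      (hr.reach (v ⟨0, k0⟩) (mem_support.2 (Or.inl ⟨_, rfl⟩))) with h1 | h1
    · exact h1
    · exfalso
      have hroot : Relation.ReflTransGen (fun a b => F.parent b = some a) (v ⟨0, k0⟩) r := by
        rcases mem_support.1 hr.root_mem with ⟨i, hi⟩ | ⟨j, hj⟩
        · exact hi ▸ hFv.reflTransGen ⟨0, k0⟩ rfl i
        · exact (hFv.reflTransGen ⟨0, k0⟩ rfl i₁).trans
            (e₁ ▸ hj ▸ hFw.reflTransGen ⟨0, k0⟩ rfl j)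
      exact F.acyclic _ (h1.trans_left hroot)
  have onv : ∀ i, v i ≠ r → F.parent (v i) = G.parent (v i) := by
    intro i hi
    rcases hFv.eq_zero_or_parent_eq hGv i with h0 | ⟨j, h1, h2⟩
    · exact absurd (v0 ▸ congrArg v (Fin.ext h0)) hi
    · rw [h1, h2]
  rcases mem_support.1 hx with ⟨i, rfl⟩ | ⟨i, rfl⟩
  · exact onv i hxr
  · rcases hFw.eq_zero_or_parent_eq hGw i with h0 | ⟨j, h1, h2⟩
    · rw [show i = ⟨0, k0⟩ from Fin.ext h0, ← e₁] at hxr ⊢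
      exact onv _ hxr
    · rw [h1, h2]

theorem Linked.parent_eq {F G : RForest n} {v w : Fin k → Fin n}
    (h : Linked v w) (hFv : F.IsPath v) (hFw : F.IsPath w) (hGv : G.IsPath v)
    (hGw : G.IsPath w) {r : Fin n} (hr : F.TreeOn (support v w) r) {x : Fin n}
    (hx : x ∈ support v w) (hxr : x ≠ r) : F.parent x = G.parent x := by
  rcases h with ⟨t, l, h⟩ | ⟨t, l, h⟩
  · exact h.parent_eq hFv hFw hGv hGw hr hx hxr
  · rw [support_comm] at hr hx
    exact h.parent_eq hFw hFv hGw hGv hr hx hxr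

theorem RForest.TreeOn.isPath_of_parent_eq {F G : RForest n} {U : Finset (Fin n)} {r : Fin n}
    (hF : F.TreeOn U r) (h : ∀ x ∈ U, x ≠ r → G.parent x = F.parent x) {v : Fin k → Fin n}
    (hv : F.IsPath v) (hU : ∀ i, v i ∈ U) : G.IsPath v := by
  intro i j hij
  have e := hv i j hij
  rw [h _ (hU j), e]
  intro hj
  exact hF.parent_root (hU i) (hj ▸ e)

theorem Linked.numExt_le {v w v' w' : Fin k → Fin n} (h : Linked v w) (h' : Linked v' w')
    (hv' : Function.Injective v') (hw' : Function.Injective w')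
    (hs : support v w = support v' w') : numExt v w ≤ numExt v' w' := by
  obtain ⟨G, hG⟩ := card_pos.1 (h'.numExt_pos hv' hw')
  obtain ⟨hGv, hGw⟩ := (mem_filter.1 hG).2
  obtain ⟨s, hGs⟩ := h'.treeOn hGv hGw
  obtain hF | ⟨F₀, hF₀⟩ :=
    (univ.filter fun F : RForest n => F.IsPath v ∧ F.IsPath w).eq_empty_or_nonempty
  · rw [numExt, hF]
    exact Nat.zero_le _
  have hF₀ := (mem_filter.1 hF₀).2
  obtain ⟨r, hr₀⟩ := h.treeOn hF₀.1 hF₀.2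
  have hroot : ∀ F : RForest n, F.IsPath v ∧ F.IsPath w → F.TreeOn (support v w) r := by
    intro F hF
    obtain ⟨r', hr'⟩ := h.treeOn hF.1 hF.2
    by_cases e : r = r'
    · rwa [e]
    · exfalso
      obtain ⟨y, hy, h1⟩ := hr₀.parent_mem r' hr'.root_mem (Ne.symm e)
      rw [h.parent_eq hF₀.1 hF₀.2 hF.1 hF.2 hr₀ hr'.root_mem (Ne.symm e)] at h1
      exact hr'.parent_root hy h1
  have hsw : ∀ F : RForest n, F.IsPath v ∧ F.IsPath w →
      ∃ H : RForest n, (∀ x ∉ support v w, H.parent x = F.parent x) ∧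
        H.parent s = F.parent r ∧ ∀ x ∈ support v w, x ≠ s → H.parent x = G.parent x :=
    fun F hF => (hroot F hF).exists_swap (hs ▸ hGs)
  choose! f hf using hsw
  refine card_le_card_of_injOn f (fun F hF => ?_) (fun F hF F' hF' e => ?_)
  · have hF := (mem_filter.1 hF).2
    obtain ⟨-, -, h3⟩ := hf F hF
    rw [hs] at h3
    refine mem_filter.2 ⟨mem_univ _, hGs.isPath_of_parent_eq h3 hGv fun i => ?_,
      hGs.isPath_of_parent_eq h3 hGw fun i => ?_⟩
    · exact mem_support.2 (Or.inl ⟨_, rfl⟩)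
    · exact mem_support.2 (Or.inr ⟨_, rfl⟩)
  · have hF := (mem_filter.1 hF).2
    have hF' := (mem_filter.1 hF').2
    obtain ⟨h1, h2, -⟩ := hf F hF
    obtain ⟨h1', h2', -⟩ := hf F' hF'
    rw [e] at h1 h2
    apply RForest.parent_injective
    funext x
    by_cases hx : x ∈ support v w
    · by_cases hxr : x = r
      · rw [hxr, ← h2, ← h2']
      · exact h.parent_eq hF.1 hF.2 hF'.1 hF'.2 (hroot F hF) hx hxr
    · rw [← h1 x hx, ← h1' x hx]

theorem numExt_le_comp {v w : Fin k → Fin n} (hv : Function.Injective v)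
    (hw : Function.Injective w) (hd : ∀ i j, v i ≠ w j) (ρ : Equiv.Perm (Fin k)) :
    numExt v w ≤ numExt (v ∘ ρ) (w ∘ ρ) := by
  have hu : Function.Injective (Sum.elim v w) := hv.sumElim hw hd
  let τ : Equiv.Perm (Fin n) :=
    (Equiv.Perm.sumCongr ρ ρ).extendDomain (Equiv.ofInjective _ hu)
  have hτ : ∀ a, τ (Sum.elim v w a) = Sum.elim v w (Equiv.Perm.sumCongr ρ ρ a) := fun a =>
    Equiv.Perm.extendDomain_apply_image (Equiv.Perm.sumCongr ρ ρ) (Equiv.ofInjective _ hu) a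
  have hτv : τ ∘ v = v ∘ ρ := funext fun i => hτ (Sum.inl i)
  have hτw : τ ∘ w = w ∘ ρ := funext fun i => hτ (Sum.inr i)
  refine card_le_card_of_injOn (fun F => F.permute τ) (fun F hF => ?_)
    (fun F _ F' _ e => RForest.permute_injective τ e)
  have hF := (mem_filter.1 hF).2
  exact mem_filter.2 ⟨mem_univ _, hτv ▸ hF.1.permute τ, hτw ▸ hF.2.permute τ⟩

theorem numExt_comp {v w : Fin k → Fin n} (hv : Function.Injective v)
    (hw : Function.Injective w) (hd : ∀ i j, v i ≠ w j) (ρ : Equiv.Perm (Fin k)) :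
    numExt (v ∘ ρ) (w ∘ ρ) = numExt v w := by
  refine le_antisymm ?_ (numExt_le_comp hv hw hd ρ)
  have := numExt_le_comp (hv.comp ρ.injective) (hw.comp ρ.injective) (fun i j => hd _ _) ρ.symm
  simpa [Function.comp_assoc] using this

end Pairs

section Counting

variable {n k : ℕ}

/-- The entries of `v` are in the same relative order as those of `π`. -/
def HasOrder (π : Pattern k) (v : Fin k → Fin n) : Prop :=
  ∀ i j : Fin k, v i < v j ↔ π i < π j

theorem HasOrder.injective {π : Pattern k} {v : Fin k → Fin n} (h : HasOrder π v) :
    Function.Injective v := by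
  intro i j e
  apply π.injective
  apply le_antisymm
  · exact not_lt.1 fun hlt => ((h _ _).2 hlt).ne e.symm
  · exact not_lt.1 fun hlt => ((h _ _).2 hlt).ne e

theorem HasOrder.comp {π : Pattern k} {v : Fin k → Fin n} (h : HasOrder π v)
    (ρ : Equiv.Perm (Fin k)) : HasOrder (ρ.trans π) (v ∘ ρ) := fun _ _ => h _ _

/-- Pairs of sequences of vertices that are both ordered like `π`. -/
noncomputable def orderedPairs (π : Pattern k) (n : ℕ) :
    Finset ((Fin k → Fin n) × (Fin k → Fin n)) :=
  univ.filter fun p => HasOrder π p.1 ∧ HasOrder π p.2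

theorem mem_orderedPairs {π : Pattern k} {p : (Fin k → Fin n) × (Fin k → Fin n)} :
    p ∈ orderedPairs π n ↔ HasOrder π p.1 ∧ HasOrder π p.2 := by
  simp [orderedPairs]

theorem sum_numExt_eq_sum_sq (π : Pattern k) (n : ℕ) :
    ∑ p ∈ orderedPairs π n, numExt p.1 p.2 =
      ∑ F : RForest n, Nat.card {v : Fin k → Fin n // IsConsInstance F π v} ^ 2 := by
  have h := sum_card_bipartiteAbove_eq_sum_card_bipartiteBelow (s := orderedPairs π n)
    (t := (univ : Finset (RForest n))) (fun p F => F.IsPath p.1 ∧ F.IsPath p.2)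
  refine Eq.trans h (sum_congr rfl fun F _ => ?_)
  rw [Nat.card_eq_fintype_card, Fintype.card_subtype, sq, ← card_product]
  congr 1
  ext p
  simp only [bipartiteBelow, mem_filter, mem_orderedPairs, mem_product, mem_univ, true_and]
  exact and_and_and_comm.trans (and_congr and_comm and_comm)

theorem strongCount_eq_card (π : Pattern k) (n m : ℕ) :
    strongCount π n m = #(univ.filter fun F : RForest n =>
      Nat.card {v : Fin k → Fin n // IsConsInstance F π v} = m) := by
  rw [strongCount, Nat.card_eq_fintype_card, Fintype.card_subtype]

theorem StrongCEquiv.sum_eq {π π' : Pattern k} (h : StrongCEquiv π π') (n : ℕ) (f : ℕ → ℕ) :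
    ∑ F : RForest n, f (Nat.card {v : Fin k → Fin n // IsConsInstance F π v}) =
      ∑ F : RForest n, f (Nat.card {v : Fin k → Fin n // IsConsInstance F π' v}) := by
  have key : ∀ (σ : Pattern k) (F : RForest n), F ∈ (univ : Finset (RForest n)) →
      Nat.card {v : Fin k → Fin n // IsConsInstance F σ v} ∈
        range (Nat.card (Fin k → Fin n) + 1) := by
    intro σ F _
    rw [mem_range, Nat.lt_succ_iff]
    exact Finite.card_subtype_le _
  rw [← sum_fiberwise_of_maps_to' (key π) f, ← sum_fiberwise_of_maps_to' (key π') f]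
  refine sum_congr rfl fun m _ => ?_
  rw [sum_const, sum_const, ← strongCount_eq_card, ← strongCount_eq_card, h m n]

theorem sum_numExt_disjoint (π π' : Pattern k) (n : ℕ) :
    ∑ p ∈ orderedPairs π n with ∀ i j, p.1 i ≠ p.2 j, numExt p.1 p.2 =
      ∑ p ∈ orderedPairs π' n with ∀ i j, p.1 i ≠ p.2 j, numExt p.1 p.2 := by
  have key : ∀ σ σ' : Pattern k, ∀ p ∈ (orderedPairs σ n).filter fun p => ∀ i j, p.1 i ≠ p.2 j,
      (p.1 ∘ (σ'.trans σ.symm), p.2 ∘ (σ'.trans σ.symm)) ∈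
        (orderedPairs σ' n).filter fun p => ∀ i j, p.1 i ≠ p.2 j := by
    intro σ σ' p hp
    simp only [mem_filter, mem_orderedPairs] at hp ⊢
    have e : (σ'.trans σ.symm).trans σ = σ' := by
      ext i
      simp
    exact ⟨⟨by simpa only [e] using hp.1.1.comp (σ'.trans σ.symm),
      by simpa only [e] using hp.1.2.comp (σ'.trans σ.symm)⟩, fun i j => hp.2 _ _⟩
  refine sum_bij' (fun p _ => (p.1 ∘ (π'.trans π.symm), p.2 ∘ (π'.trans π.symm)))
    (fun p _ => (p.1 ∘ (π.trans π'.symm), p.2 ∘ (π.trans π'.symm)))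
    (key π π') (key π' π) (fun p _ => ?_) (fun p _ => ?_) (fun p hp => ?_)
  · ext <;> simp
  · ext <;> simp
  · obtain ⟨h1, h2⟩ := mem_filter.1 hp
    rw [mem_orderedPairs] at h1
    exact (numExt_comp h1.1.injective h1.2.injective h2 _).symm

theorem sum_numExt_split (π : Pattern k) (n : ℕ) :
    ∑ p ∈ orderedPairs π n, numExt p.1 p.2 =
      ∑ p ∈ orderedPairs π n with ∀ i j, p.1 i ≠ p.2 j, numExt p.1 p.2 +
      ∑ p ∈ orderedPairs π n with Linked p.1 p.2, numExt p.1 p.2 := by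
  rw [← sum_filter_add_sum_filter_not _ (fun p => ∀ i j, p.1 i ≠ p.2 j)]
  congr 1
  symm
  apply sum_subset
  · intro p hp
    rw [mem_filter] at hp ⊢
    exact ⟨hp.1, hp.2.not_disjoint⟩
  · intro p hp hp'
    rw [mem_filter] at hp hp'
    by_contra h0
    exact hp' ⟨hp.1, linked_of_numExt_ne_zero h0 hp.2⟩

/-- Pairs of linked sequences of vertices, ordered like `π`, that together cover `U`. -/
noncomputable def linkedPairs (π : Pattern k) (U : Finset (Fin n)) :
    Finset ((Fin k → Fin n) × (Fin k → Fin n)) :=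
  (orderedPairs π n).filter fun p => Linked p.1 p.2 ∧ support p.1 p.2 = U

theorem mem_linkedPairs {π : Pattern k} {U : Finset (Fin n)}
    {p : (Fin k → Fin n) × (Fin k → Fin n)} :
    p ∈ linkedPairs π U ↔
      HasOrder π p.1 ∧ HasOrder π p.2 ∧ Linked p.1 p.2 ∧ support p.1 p.2 = U := by
  simp [linkedPairs, mem_orderedPairs, and_assoc]

/-- The number of forests containing a given pair of linked paths depends only on the vertices
of the paths. -/
theorem exists_numExt_eq (k : ℕ) (U : Finset (Fin n)) : ∃ g : ℕ, 0 < g ∧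
    ∀ (π : Pattern k), ∀ p ∈ linkedPairs π U, numExt p.1 p.2 = g := by
  by_cases hex : ∃ (π : Pattern k), ∃ p, p ∈ linkedPairs π U
  · obtain ⟨π, p, hp⟩ := hex
    obtain ⟨h1, h2, h3, h4⟩ := mem_linkedPairs.1 hp
    refine ⟨numExt p.1 p.2, h3.numExt_pos h1.injective h2.injective, fun π' p' hp' => ?_⟩
    obtain ⟨h1', h2', h3', h4'⟩ := mem_linkedPairs.1 hp'
    exact le_antisymm (h3'.numExt_le h3 h1.injective h2.injective (h4'.trans h4.symm))
      (h3.numExt_le h3' h1'.injective h2'.injective (h4.trans h4'.symm))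
  · push Not at hex
    exact ⟨1, one_pos, fun π p hp => absurd hp (hex π p)⟩

theorem sum_numExt_linked {g : Finset (Fin n) → ℕ} {π : Pattern k}
    (hg : ∀ U, ∀ p ∈ linkedPairs π U, numExt p.1 p.2 = g U) :
    ∑ p ∈ orderedPairs π n with Linked p.1 p.2, numExt p.1 p.2 =
      ∑ U : Finset (Fin n), #(linkedPairs π U) * g U := by
  rw [← sum_fiberwise _ (fun p => support p.1 p.2)]
  refine sum_congr rfl fun U _ => ?_
  rw [filter_filter]
  exact sum_const_nat (hg U)

theorem Attached.map_iff {m : ℕ} (e : Fin m ↪ Fin n) {v w : Fin k → Fin m} {t : Fin k} {l : ℕ} :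
    Attached (e ∘ v) (e ∘ w) t l ↔ Attached v w t l := by
  simp [Attached]

theorem Linked.map_iff {m : ℕ} (e : Fin m ↪ Fin n) {v w : Fin k → Fin m} :
    Linked (e ∘ v) (e ∘ w) ↔ Linked v w := by
  simp only [Linked, Attached.map_iff]

theorem card_linkedPairs (π : Pattern k) (U : Finset (Fin n)) :
    #(linkedPairs π U) = #(linkedPairs π (univ : Finset (Fin #U))) := by
  let e := U.orderEmbOfFin rfl
  have he : ∀ x ∈ U, ∃ y, e y = x := by
    intro x hx
    have : x ∈ Set.range e := by
      rw [range_orderEmbOfFin]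
      exact hx
    exact this
  have hord : ∀ v : Fin k → Fin #U, HasOrder π (e ∘ v) ↔ HasOrder π v := fun v => by
    simp [HasOrder]
  have hsup : ∀ v w : Fin k → Fin #U, support (e ∘ v) (e ∘ w) = U ↔ support v w = univ := by
    intro v w
    have h1 : support (e ∘ v) (e ∘ w) = (support v w).map e.toEmbedding := by
      ext x
      simp only [mem_support, mem_map, Function.comp_apply]
      constructor
      · rintro (⟨i, rfl⟩ | ⟨i, rfl⟩)
        · exact ⟨_, Or.inl ⟨i, rfl⟩, rfl⟩
        · exact ⟨_, Or.inr ⟨i, rfl⟩, rfl⟩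
      · rintro ⟨y, ⟨i, rfl⟩ | ⟨i, rfl⟩, rfl⟩
        · exact Or.inl ⟨i, rfl⟩
        · exact Or.inr ⟨i, rfl⟩
    have h2 : U = univ.map e.toEmbedding := by
      simp [e]
    rw [h1]
    exact ⟨fun h => map_inj.1 (h.trans h2), fun h => (congrArg _ h).trans h2.symm⟩
  symm
  refine card_bij (fun p _ => (e ∘ p.1, e ∘ p.2)) (fun p hp => ?_) (fun p _ q _ h => ?_)
    (fun q hq => ?_)
  · rw [mem_linkedPairs] at hp ⊢
    exact ⟨(hord _).2 hp.1, (hord _).2 hp.2.1, (Linked.map_iff e.toEmbedding).2 hp.2.2.1,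
      (hsup _ _).2 hp.2.2.2⟩
  · obtain ⟨h1, h2⟩ := Prod.ext_iff.1 h
    exact Prod.ext (e.injective.comp_left h1) (e.injective.comp_left h2)
  · obtain ⟨v', w'⟩ := q
    rw [mem_linkedPairs] at hq
    have hv : ∀ i, ∃ y, e y = v' i := fun i =>
      he _ (hq.2.2.2 ▸ mem_support.2 (Or.inl ⟨i, rfl⟩))
    have hw : ∀ i, ∃ y, e y = w' i := fun i =>
      he _ (hq.2.2.2 ▸ mem_support.2 (Or.inr ⟨i, rfl⟩))
    choose v hv using hv
    choose w hw using hw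
    obtain rfl : e ∘ v = v' := funext hv
    obtain rfl : e ∘ w = w' := funext hw
    exact ⟨(v, w), mem_linkedPairs.2 ⟨(hord _).1 hq.1, (hord _).1 hq.2.1,
      (Linked.map_iff e.toEmbedding).1 hq.2.2.1, (hsup _ _).1 hq.2.2.2⟩, rfl⟩

theorem StrongCEquiv.card_linkedPairs_eq {π π' : Pattern k} (h : StrongCEquiv π π') (m : ℕ) :
    #(linkedPairs π (univ : Finset (Fin m))) = #(linkedPairs π' (univ : Finset (Fin m))) := by
  induction m using Nat.strong_induction_on with
  | _ m ih =>
    have total : ∑ p ∈ orderedPairs π m, numExt p.1 p.2 =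
        ∑ p ∈ orderedPairs π' m, numExt p.1 p.2 := by
      rw [sum_numExt_eq_sum_sq, sum_numExt_eq_sum_sq]
      exact h.sum_eq m (· ^ 2)
    rw [sum_numExt_split, sum_numExt_split, sum_numExt_disjoint π π', Nat.add_left_cancel_iff]
      at total
    choose g hg0 hg using fun U : Finset (Fin m) => exists_numExt_eq k U
    rw [sum_numExt_linked (fun U => hg U π), sum_numExt_linked (fun U => hg U π'),
      ← add_sum_erase _ _ (mem_univ univ), ← add_sum_erase _ _ (mem_univ univ)] at total
    have rest : ∑ U ∈ univ.erase (univ : Finset (Fin m)), #(linkedPairs π U) * g U =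
        ∑ U ∈ univ.erase (univ : Finset (Fin m)), #(linkedPairs π' U) * g U := by
      refine sum_congr rfl fun U hU => ?_
      have hlt : #U < m := by
        simpa using (card_lt_iff_ne_univ U).2 (mem_erase.1 hU).1
      rw [card_linkedPairs π U, card_linkedPairs π' U, ih _ hlt]
    rw [rest, Nat.add_right_cancel_iff] at total
    exact Nat.eq_of_mul_eq_mul_right (hg0 univ) total

end Counting

section Attached

variable {n m k : ℕ}

theorem Attached.card_support {v w : Fin k → Fin n} {t : Fin k} {l : ℕ} (h : Attached v w t l)
    (hv : Function.Injective v) (hw : Function.Injective w) : #(support v w) + l = 2 * k := by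
  have hl : l ≤ k := h.2.1.trans t.2
  have hi : univ.image v ∩ univ.image w = (univ.filter fun j : Fin k => (j : ℕ) < l).image w := by
    ext x
    simp only [mem_inter, mem_image, mem_univ, true_and, mem_filter]
    constructor
    · rintro ⟨⟨i, rfl⟩, j, hj⟩
      exact ⟨j, ((h.2.2 _ _).1 hj.symm).2, hj⟩
    · rintro ⟨j, hj, rfl⟩
      obtain ⟨i, -, hi⟩ := h.exists_eq j hj
      exact ⟨⟨i, hi⟩, j, rfl⟩
  have hc : #(univ.image v ∩ univ.image w) = l := by
    rw [hi, card_image_of_injective _ hw, Fin.card_filter_val_lt, min_eq_right hl]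
  have := card_union_add_card_inter (univ.image v) (univ.image w)
  rw [card_image_of_injective _ hv, card_image_of_injective _ hw, hc, card_univ,
    Fintype.card_fin] at this
  rw [support, this]
  omega

/-- Pairs of sequences ordered like `π`, the second attached to the first at position `t`
with overlap `l`. -/
noncomputable def attachedPairs (π : Pattern k) (m : ℕ) (t : Fin k) (l : ℕ) :
    Finset ((Fin k → Fin m) × (Fin k → Fin m)) :=
  (orderedPairs π m).filter fun p => Attached p.1 p.2 t l

theorem mem_attachedPairs {π : Pattern k} {t : Fin k} {l : ℕ}
    {p : (Fin k → Fin m) × (Fin k → Fin m)} : p ∈ attachedPairs π m t l ↔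
      HasOrder π p.1 ∧ HasOrder π p.2 ∧ Attached p.1 p.2 t l := by
  simp [attachedPairs, mem_orderedPairs, and_assoc]

theorem support_eq_univ_iff {v w : Fin k → Fin m} : support v w = univ ↔ #(support v w) = m := by
  rw [← card_eq_iff_eq_univ, Fintype.card_fin]

theorem card_linkedPairs_univ (π : Pattern k) {l : ℕ} (hm : m + l = 2 * k) (o : Fin k)
    (ho : (o : ℕ) + 1 = l) :
    #(linkedPairs π (univ : Finset (Fin m))) + #(attachedPairs π m o l) =
      2 * ∑ t, #(attachedPairs π m t l) := by
  set A := univ.biUnion fun t => attachedPairs π m t l with hA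
  have memA : ∀ p, p ∈ A ↔ HasOrder π p.1 ∧ HasOrder π p.2 ∧ ∃ t, Attached p.1 p.2 t l := by
    intro p
    simp [hA, mem_attachedPairs]
  have cardA : #A = ∑ t, #(attachedPairs π m t l) := by
    refine card_biUnion fun t _ t' _ hne => disjoint_left.2 fun p hp hp' => hne ?_
    obtain ⟨-, -, h⟩ := mem_attachedPairs.1 hp
    obtain ⟨-, -, h'⟩ := mem_attachedPairs.1 hp'
    obtain ⟨i, hi, e⟩ := h.exists_eq ⟨0, t.pos⟩ h.1
    have := ((h'.2.2 _ _).1 e).1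
    ext
    omega
  set B := A.map (Equiv.prodComm _ _).toEmbedding with hB
  have memB : ∀ p, p ∈ B ↔ HasOrder π p.1 ∧ HasOrder π p.2 ∧ ∃ t, Attached p.2 p.1 t l := by
    intro p
    rw [hB, mem_map_equiv, memA]
    simp only [Equiv.prodComm_symm, Equiv.prodComm_apply, Prod.fst_swap, Prod.snd_swap]
    tauto
  have hunion : linkedPairs π (univ : Finset (Fin m)) = A ∪ B := by
    ext p
    rw [mem_union, memA, memB, mem_linkedPairs, support_eq_univ_iff]
    constructor
    · rintro ⟨h1, h2, ⟨t, l', h⟩ | ⟨t, l', h⟩, hs⟩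
      · have := h.card_support h1.injective h2.injective
        exact Or.inl ⟨h1, h2, t, by rwa [show l = l' by omega]⟩
      · have := h.card_support h2.injective h1.injective
        rw [support_comm] at hs
        exact Or.inr ⟨h1, h2, t, by rwa [show l = l' by omega]⟩
    · rintro (⟨h1, h2, t, h⟩ | ⟨h1, h2, t, h⟩)
      · have := h.card_support h1.injective h2.injective
        exact ⟨h1, h2, Or.inl ⟨t, l, h⟩, by omega⟩
      · have := h.card_support h2.injective h1.injective
        rw [support_comm] at this
        exact ⟨h1, h2, Or.inr ⟨t, l, h⟩, by omega⟩
  have hinter : attachedPairs π m o l = A ∩ B := by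
    ext p
    rw [mem_inter, memA, memB, mem_attachedPairs]
    constructor
    · rintro ⟨h1, h2, h⟩
      refine ⟨⟨h1, h2, o, h⟩, h1, h2, o, h.1, h.2.1, fun i j => ?_⟩
      rw [eq_comm, h.2.2]
      omega
    · rintro ⟨⟨h1, h2, t, h⟩, -, -, t', h'⟩
      obtain ⟨i, hi, e⟩ := h'.exists_eq ⟨0, t.pos⟩ h.1
      have h3 := ((h.2.2 _ _).1 e.symm).1
      have h4 := h.2.1
      have : t = o := Fin.ext (by simp only at h3; omega)
      exact ⟨h1, h2, this ▸ h⟩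
  rw [hunion, hinter, card_union_add_card_inter, card_map, cardA, two_mul]

theorem HasOrder.eq_of_image_eq {π : Pattern k} {v w : Fin k → Fin m} (hv : HasOrder π v)
    (hw : HasOrder π w) (h : univ.image v = univ.image w) : v = w := by
  have mono : ∀ u : Fin k → Fin m, HasOrder π u → StrictMono (u ∘ π.symm) := fun u hu i j hij =>
    (hu _ _).2 (by simpa using hij)
  have hr : ∀ u : Fin k → Fin m, Set.range (u ∘ π.symm) = (univ.image u : Finset (Fin m)) := by
    intro u
    rw [π.symm.surjective.range_comp]
    simp
  have := (mono v hv).range_inj (mono w hw) |>.1 (by rw [hr, hr, h])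
  exact π.symm.surjective.injective_comp_right this

theorem card_filter_lt_of_hasOrder {π : Pattern k} {v : Fin k → Fin m} (hv : HasOrder π v)
    (i : Fin k) : #((univ.image v).filter (· < v i)) = π i := by
  have : (univ.image v).filter (· < v i) = (Iio (π i)).image (v ∘ π.symm) := by
    ext x
    simp only [mem_filter, mem_image, mem_univ, true_and, mem_Iio, Function.comp_apply]
    constructor
    · rintro ⟨⟨j, rfl⟩, hj⟩
      exact ⟨π j, (hv _ _).1 hj, by simp⟩
    · rintro ⟨j, hj, rfl⟩
      exact ⟨⟨_, rfl⟩, (hv _ _).2 (by simpa using hj)⟩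
  rw [this, card_image_of_injective _ (hv.injective.comp π.symm.injective), Fin.card_Iio]

/-- A linked pair covering everything is determined by the complement of its first path. -/
theorem attachedPairs_injOn (π : Pattern k) {l : ℕ} (hm : m + l = 2 * k) (t : Fin k) :
    Set.InjOn (fun p : (Fin k → Fin m) × (Fin k → Fin m) => (univ.image p.1)ᶜ)
      (attachedPairs π m t l) := by
  rintro ⟨v, w⟩ hp ⟨v', w'⟩ hp' e
  obtain ⟨h1, h2, h⟩ := mem_attachedPairs.1 hp
  obtain ⟨h1', h2', h'⟩ := mem_attachedPairs.1 hp'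
  simp only at h1 h2 h h1' h2' h' e
  obtain rfl : v = v' := h1.eq_of_image_eq h1' (compl_injective e)
  have key : ∀ w : Fin k → Fin m, HasOrder π w → Attached v w t l → ∀ x, x ∈ univ.image w ↔
      x ∉ univ.image v ∨ ∃ i : Fin k, (t : ℕ) + 1 ≤ i + l ∧ i ≤ t ∧ v i = x := by
    intro w hw h x
    have hs : support v w = univ := by
      have := h.card_support h1.injective hw.injective
      rw [support_eq_univ_iff]
      omega
    have hx : x ∈ support v w := hs ▸ mem_univ x
    have hl := h.2.1
    constructor
    · intro hxw
      by_cases hxv : x ∈ univ.image v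
      · obtain ⟨j, -, rfl⟩ := mem_image.1 hxw
        obtain ⟨i, -, e⟩ := mem_image.1 hxv
        have := (h.2.2 _ _).1 e
        exact Or.inr ⟨i, by omega, by rw [Fin.le_def]; omega, e⟩
      · exact Or.inl hxv
    · rintro (hxv | ⟨i, hi, hit, rfl⟩)
      · exact (mem_union.1 hx).resolve_left hxv
      · have hi' := i.2
        have hit : (i : ℕ) ≤ t := hit
        exact mem_image.2 ⟨⟨i + l - (t + 1), by omega⟩, mem_univ _,
          ((h.2.2 _ _).2 ⟨by simp only; omega, by simp only; omega⟩).symm⟩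
  obtain rfl : w = w' := h2.eq_of_image_eq h2' (by
    ext x
    rw [key w h2 h, key w' h2' h'])
  rfl

theorem card_compl_image {v : Fin k → Fin m} (hv : Function.Injective v) :
    #(univ.image v)ᶜ = m - k := by
  rw [card_compl, card_image_of_injective _ hv, card_univ, Fintype.card_fin, Fintype.card_fin]

theorem val_eq_card_filter_lt (x : Fin m) : #(univ.filter (· < x)) = (x : ℕ) := by
  rw [filter_gt_eq_Iio, Fin.card_Iio]

/-- If both paths start at the same vertex, the label of a common vertex is determined. -/
theorem Attached.val_add_card {π : Pattern k} {v w : Fin k → Fin m} {t : Fin k} {l : ℕ}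
    (hm : m + l = 2 * k) (hv : HasOrder π v) (hw : HasOrder π w) (h : Attached v w t l)
    (ht : (t : ℕ) + 1 = l) (i : Fin k) (hi : (i : ℕ) < l) :
    (v i : ℕ) + #(univ.filter fun j : Fin k => (j : ℕ) < l ∧ π j < π i) = 2 * π i := by
  have eqv : ∀ j : Fin k, (j : ℕ) < l → v j = w j := fun j hj => (h.2.2 _ _).2 ⟨by omega, hj⟩
  have hs : support v w = univ := by
    have := h.card_support hv.injective hw.injective
    rw [support_eq_univ_iff]
    omega
  have hu := card_union_add_card_inter ((univ.image v).filter (· < v i))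
    ((univ.image w).filter (· < v i))
  have hw' : #((univ.image w).filter (· < v i)) = π i := by
    rw [eqv i hi]
    exact card_filter_lt_of_hasOrder hw i
  rw [← filter_union, ← support, hs, val_eq_card_filter_lt, card_filter_lt_of_hasOrder hv,
    hw'] at hu
  have hinter : (univ.image v).filter (· < v i) ∩ (univ.image w).filter (· < v i) =
      (univ.filter fun j : Fin k => (j : ℕ) < l ∧ π j < π i).image v := by
    ext x
    simp only [mem_inter, mem_filter, mem_image, mem_univ, true_and]
    constructor
    · rintro ⟨⟨⟨j, rfl⟩, hj⟩, ⟨j', e⟩, -⟩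
      have := (h.2.2 _ _).1 e.symm
      exact ⟨j, ⟨by omega, (hv _ _).1 hj⟩, rfl⟩
    · rintro ⟨j, ⟨hjl, hj⟩, rfl⟩
      have := (hv _ _).2 hj
      exact ⟨⟨⟨j, rfl⟩, this⟩, ⟨j, (eqv j hjl).symm⟩, this⟩
  rw [hinter, card_image_of_injective _ hv.injective] at hu
  omega

theorem card_attachedPairs_le (π : Pattern k) {l : ℕ} (hm : m + l = 2 * k) (t : Fin k)
    (ht : (t : ℕ) + 1 = l) : #(attachedPairs π m t l) ≤ (2 * (k - l)).choose (k - l) := by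
  obtain h0 | ⟨⟨v₀, w₀⟩, h₀⟩ := (attachedPairs π m t l).eq_empty_or_nonempty
  · rw [h0]
    exact Nat.zero_le _
  obtain ⟨hv₀, hw₀, h₀⟩ := mem_attachedPairs.1 h₀
  simp only at hv₀ hw₀ h₀
  have htk := t.2
  let Q := (univ.filter fun j : Fin k => (j : ℕ) < l).image v₀
  have hQ : #Qᶜ = 2 * (k - l) := by
    rw [card_compl, card_image_of_injective _ hv₀.injective, Fintype.card_fin,
      Fin.card_filter_val_lt, min_eq_right (by omega)]
    omega
  have hcard : #(powersetCard (k - l) Qᶜ) = (2 * (k - l)).choose (k - l) := by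
    rw [card_powersetCard, hQ]
  rw [← hcard]
  refine card_le_card_of_injOn _ (fun p hp => ?_) (attachedPairs_injOn π hm t)
  obtain ⟨hv, hw, h⟩ := mem_attachedPairs.1 hp
  refine mem_powersetCard.2 ⟨compl_subset_compl.2 fun x hx => ?_, ?_⟩
  · obtain ⟨i, hi, rfl⟩ := mem_image.1 hx
    have hi := (mem_filter.1 hi).2
    have h1 := h.val_add_card hm hv hw ht i hi
    have h2 := h₀.val_add_card hm hv₀ hw₀ ht i hi
    exact mem_image.2 ⟨i, mem_univ _, Fin.ext (by omega)⟩
  · rw [card_compl_image hv.injective]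
    omega

end Attached

section Rising

variable {m k : ℕ}

/-- The `l` consecutive entries of `π` ending at position `t` are increasing. -/
def Rising (π : Pattern k) (t : Fin k) (l : ℕ) : Prop :=
  ∀ a b : Fin k, (t : ℕ) < (a : ℕ) + l → (b : ℕ) = (a : ℕ) + 1 → (b : ℕ) ≤ (t : ℕ) → π a < π b

theorem Rising.lt {π : Pattern k} {t : Fin k} {l : ℕ} (h : Rising π t l) {a b : Fin k}
    (ha : (t : ℕ) < a + l) (hab : a < b) (hb : b ≤ t) : π a < π b := by
  have key : ∀ d : ℕ, ∀ b : Fin k, (b : ℕ) = a + d + 1 → b ≤ t → π a < π b := by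
    intro d
    induction d with
    | zero => exact fun b hb hbt => h a b ha hb hbt
    | succ d ih =>
      intro b hb hbt
      have hb' := b.2
      have hbt : (b : ℕ) ≤ t := hbt
      exact (ih ⟨a + d + 1, by omega⟩ rfl (Fin.le_def.2 (by simp only; omega))).trans
        (h _ _ (by simp only; omega) hb hbt)
  have hab : (a : ℕ) < b := hab
  exact key (b - a - 1) b (by omega) hb

theorem Attached.rising {π : Pattern k} {v w : Fin k → Fin m} {t : Fin k} {l : ℕ}
    (h : Attached v w t l) (hv : HasOrder π v) (hw : HasOrder π w)
    (hπ : ∀ i j : Fin k, i < j → (j : ℕ) < l → π i < π j) : Rising π t l := by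
  intro a b ha hab hb
  have h1 := h.2.1
  have hb' := b.2
  have e1 : v a = w ⟨a + l - (t + 1), by omega⟩ :=
    (h.2.2 _ _).2 ⟨by simp only; omega, by simp only; omega⟩
  have e2 : v b = w ⟨b + l - (t + 1), by omega⟩ :=
    (h.2.2 _ _).2 ⟨by simp only; omega, by simp only; omega⟩
  rw [← hv, e1, e2, hw]
  exact hπ _ _ (Fin.lt_def.2 (by simp only; omega)) (by simp only; omega)

theorem le_of_fixes_lt {π : Pattern k} {l : ℕ} (hl : ∀ i : Fin k, (i : ℕ) < l → (π i : ℕ) = i)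
    {j : Fin k} (hj : l ≤ j) : l ≤ π j := by
  by_contra hlt
  have := π.injective (Fin.ext (hl (π j) (not_le.1 hlt)))
  omega

/-- If the first `l` entries of `π` are its smallest ones in order, then the second path of an
attached pair leaves the first one above the label of the last common vertex. -/
theorem card_attachedPairs_eq {π : Pattern k} {l : ℕ} (hm : m + l = 2 * k) (t : Fin k)
    (hl1 : 1 ≤ l) (hlt : l ≤ t + 1) (hl : ∀ i : Fin k, (i : ℕ) < l → (π i : ℕ) = i)
    (hr : Rising π t l) :
    #(attachedPairs π m t l) = (k - l + (k - 1 - π t)).choose (k - l) := by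
  have htk := t.2
  have hπt := (π t).2
  have hcard : #(powersetCard (k - l) (Ioi (⟨π t, by omega⟩ : Fin m))) =
      (k - l + (k - 1 - π t)).choose (k - l) := by
    rw [card_powersetCard, Fin.card_Ioi]
    congr 1
    simp only
    omega
  rw [← hcard]
  refine card_nbij _ (fun p hp => ?_) (attachedPairs_injOn π hm t) (fun D hD => ?_)
  · obtain ⟨hv, hw, h⟩ := mem_attachedPairs.1 hp
    refine mem_powersetCard.2 ⟨fun x hx => ?_, ?_⟩
    · rw [mem_compl] at hx
      have hs : support p.1 p.2 = univ := by
        have := h.card_support hv.injective hw.injective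
        rw [support_eq_univ_iff]
        omega
      have hxs : x ∈ support p.1 p.2 := hs ▸ mem_univ x
      obtain ⟨j, -, rfl⟩ := mem_image.1 ((mem_union.1 hxs).resolve_left hx)
      have hj : l ≤ j := by
        by_contra hj
        obtain ⟨i, -, e⟩ := h.exists_eq j (not_le.1 hj)
        exact hx (mem_image.2 ⟨i, mem_univ _, e⟩)
      have e : p.1 t = p.2 ⟨l - 1, by omega⟩ :=
        (h.2.2 _ _).2 ⟨by simp only; omega, by simp only; omega⟩
      have h1 : p.1 t < p.2 j := by
        rw [e, hw, Fin.lt_def, hl _ (by simp only; omega)]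
        have := le_of_fixes_lt hl hj
        simp only
        omega
      have h2 : (π t : ℕ) ≤ p.1 t := by
        rw [← card_filter_lt_of_hasOrder hv, ← val_eq_card_filter_lt (p.1 t)]
        exact card_le_card (filter_subset_filter _ (subset_univ _))
      rw [mem_Ioi, Fin.lt_def]
      exact h2.trans_lt h1
    · rw [card_compl_image hv.injective]
      omega
  · obtain ⟨hDs, hDc⟩ := mem_powersetCard.1 (mem_coe.1 hD)
    have hDc' : #Dᶜ = k := by
      rw [card_compl, hDc, Fintype.card_fin]
      omega
    let e := Dᶜ.orderEmbOfFin hDc'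
    let f := D.orderEmbOfFin hDc
    let v : Fin k → Fin m := fun i => e (π i)
    have hv : HasOrder π v := fun i j => e.lt_iff_lt
    have himg : univ.image v = Dᶜ := by
      rw [← coe_inj, coe_image, coe_univ, Set.image_univ, ← range_orderEmbOfFin Dᶜ hDc']
      exact π.surjective.range_comp e
    have hvD : ∀ i, v i ∉ D := fun i =>
      mem_compl.1 (himg ▸ mem_image.2 ⟨i, mem_univ _, rfl⟩)
    have hfD : ∀ q, f q ∈ D := fun q => D.orderEmbOfFin_mem hDc q
    have hvt : (v t : ℕ) ≤ π t := by
      by_contra hcon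
      have hsub : Iic (⟨π t, by omega⟩ : Fin m) ⊆ (univ.image v).filter (· < v t) := by
        intro x hx
        have hx : (x : ℕ) ≤ π t := Fin.le_def.1 (mem_Iic.1 hx)
        refine mem_filter.2 ⟨?_, Fin.lt_def.2 (by omega)⟩
        rw [himg, mem_compl]
        intro hxD
        have : (π t : ℕ) < x := Fin.lt_def.1 (mem_Ioi.1 (hDs hxD))
        omega
      have := card_le_card hsub
      rw [card_filter_lt_of_hasOrder hv, Fin.card_Iic] at this
      simp only at this
      omega
    have hltD : ∀ x ∈ D, v t < x := by
      intro x hx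
      have : (π t : ℕ) < x := Fin.lt_def.1 (mem_Ioi.1 (hDs hx))
      exact Fin.lt_def.2 (by omega)
    let w : Fin k → Fin m := fun j =>
      if h : (j : ℕ) < l then v ⟨t + 1 + j - l, by omega⟩ else
        f ⟨π j - l, by
          have := (π j).2
          have := le_of_fixes_lt hl (not_lt.1 h)
          omega⟩
    have w1 : ∀ j : Fin k, (h : (j : ℕ) < l) → w j = v ⟨t + 1 + j - l, by omega⟩ :=
      fun j h => by simp only [w, dif_pos h]
    have w2 : ∀ j : Fin k, (h : l ≤ (j : ℕ)) → ∃ q : Fin (k - l), (q : ℕ) + l = π j ∧ w j = f q := by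
      intro j h
      have h1 := (π j).2
      have h2 := le_of_fixes_lt hl h
      exact ⟨⟨π j - l, by omega⟩, by simp only; omega, by simp only [w, dif_neg (not_lt.2 h)]⟩
    have hvle : ∀ i : Fin k, i ≤ t → (t : ℕ) < i + l → v i ≤ v t := by
      intro i hi hil
      rcases hi.eq_or_lt with rfl | hi
      · exact le_rfl
      · exact ((hv _ _).2 (hr.lt hil hi le_rfl)).le
    have hw_lt : ∀ i j : Fin k, π i < π j → w i < w j := by
      intro i j hij
      rcases lt_or_ge (i : ℕ) l with hi | hi <;> rcases lt_or_ge (j : ℕ) l with hj | hj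
      · rw [w1 i hi, w1 j hj, hv]
        rw [Fin.lt_def, hl i hi, hl j hj] at hij
        exact hr.lt (by simp only; omega) (Fin.lt_def.2 (by simp only; omega))
          (Fin.le_def.2 (by simp only; omega))
      · obtain ⟨q, -, e⟩ := w2 j hj
        rw [w1 i hi, e]
        exact (hvle _ (Fin.le_def.2 (by simp only; omega)) (by simp only; omega)).trans_lt
          (hltD _ (hfD q))
      · have := le_of_fixes_lt hl hi
        rw [Fin.lt_def, hl j hj] at hij
        omega
      · obtain ⟨q, hq, e⟩ := w2 i hi
        obtain ⟨q', hq', e'⟩ := w2 j hj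
        rw [e, e', f.lt_iff_lt]
        exact Fin.lt_def.2 (by rw [Fin.lt_def] at hij; omega)
    have hw : HasOrder π w := by
      refine fun i j => ⟨fun h => ?_, hw_lt i j⟩
      by_contra hcon
      rcases (not_lt.1 hcon).eq_or_lt with h' | h'
      · rw [π.injective h'] at h
        exact lt_irrefl _ h
      · exact lt_asymm h (hw_lt _ _ h')
    refine ⟨(v, w), mem_coe.2 (mem_attachedPairs.2 ⟨hv, hw, hl1, hlt, fun i j => ?_⟩), ?_⟩
    · show v i = w j ↔ _
      rcases lt_or_ge (j : ℕ) l with hj | hj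
      · rw [w1 j hj, hv.injective.eq_iff, Fin.ext_iff]
        simp only
        omega
      · obtain ⟨q, -, e⟩ := w2 j hj
        rw [e]
        exact ⟨fun h => absurd (h ▸ hfD q) (hvD i), fun h => by omega⟩
    · simp only [himg, compl_compl]

end Rising

section Heights

variable {k : ℕ}

theorem le_heightAt_iff (π : Pattern k) (t : Fin k) (l : ℕ) :
    l ≤ heightAt π t ↔ l ≤ t ∧ Rising π t l := by
  have hbdd : BddAbove {m | m ≤ (t : ℕ) ∧ Rising π t m} := ⟨t, fun _ h => h.1⟩
  have hmem : heightAt π t ∈ {m | m ≤ (t : ℕ) ∧ Rising π t m} :=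
    Nat.sSup_mem ⟨0, Nat.zero_le _, fun a b h1 h2 h3 => by omega⟩ hbdd
  constructor
  · intro h
    exact ⟨h.trans hmem.1, fun a b ha hab hb => hmem.2 a b (by omega) hab hb⟩
  · exact fun h => le_csSup hbdd h

theorem le_streak_iff (π : Pattern k) (l : ℕ) :
    l ≤ streak π ↔ l ≤ k ∧ ∀ i : Fin k, (i : ℕ) < l → (π i : ℕ) = i := by
  have hbdd : BddAbove {m | m ≤ k ∧ ∀ i : Fin k, (i : ℕ) < m → (π i : ℕ) = (i : ℕ)} :=
    ⟨k, fun _ h => h.1⟩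
  have hmem : streak π ∈ {m | m ≤ k ∧ ∀ i : Fin k, (i : ℕ) < m → (π i : ℕ) = (i : ℕ)} :=
    Nat.sSup_mem ⟨0, Nat.zero_le _, fun i h => by omega⟩ hbdd
  constructor
  · intro h
    exact ⟨h.trans hmem.1, fun i hi => hmem.2 i (by omega)⟩
  · exact fun h => le_csSup hbdd h

theorem streak_fixes (π : Pattern k) (i : Fin k) (hi : (i : ℕ) < streak π) : (π i : ℕ) = i :=
  ((le_streak_iff π _).1 le_rfl).2 i hi

theorem Grounded.heightAt_le {π : Pattern k} (h : Grounded π) (t : Fin k) :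
    heightAt π t ≤ streak π := by
  rcases Nat.eq_zero_or_pos (t : ℕ) with h0 | h0
  · have := ((le_heightAt_iff π t _).1 le_rfl).1
    omega
  · have hbdd : BddAbove {h | ∃ t : Fin k, 0 < (t : ℕ) ∧ h = heightAt π t} := by
      refine ⟨k, ?_⟩
      rintro _ ⟨s, -, rfl⟩
      exact ((le_heightAt_iff π s _).1 le_rfl).1.trans s.2.le
    exact (le_csSup hbdd ⟨t, h0, rfl⟩).trans h.2

theorem Grounded.streak_lt {π : Pattern k} (h : Grounded π) : streak π < k := by
  by_contra hcon
  refine h.1 (Equiv.ext fun i => Fin.ext ?_)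
  exact streak_fixes π i (i.2.trans_le (not_lt.1 hcon))

theorem streak_le_apply (π : Pattern k) {j : Fin k} (hj : streak π ≤ j) : streak π ≤ π j :=
  le_of_fixes_lt (streak_fixes π) hj

theorem lt_of_le_streak (π : Pattern k) {i j : Fin k} (hij : i < j) (hj : (j : ℕ) ≤ streak π) :
    π i < π j := by
  have hij' : (i : ℕ) < j := hij
  have h1 := streak_fixes π i (by omega)
  rw [Fin.lt_def, h1]
  rcases hj.eq_or_lt with h | h
  · have := streak_le_apply π h.ge
    omega
  · rw [streak_fixes π j h]
    omega

theorem attachedPairs_eq_empty {m l : ℕ} {π : Pattern k} (hl : l ≤ streak π + 1) {t : Fin k}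
    (ht : (t : ℕ) + 1 ≠ l) (hh : ¬ l ≤ heightAt π t) : attachedPairs π m t l = ∅ := by
  refine eq_empty_of_forall_notMem fun p hp => hh ?_
  obtain ⟨hv, hw, h⟩ := mem_attachedPairs.1 hp
  have := h.2.1
  exact (le_heightAt_iff _ _ _).2 ⟨by omega,
    h.rising hv hw fun i j hij hj => lt_of_le_streak π hij (by omega)⟩

theorem card_linkedPairs_of_le_streak {m l : ℕ} {π : Pattern k} (hm : m + l = 2 * k)
    (hl1 : 1 ≤ l) (hl : l ≤ streak π) :
    #(linkedPairs π (univ : Finset (Fin m))) = (2 * (k - l)).choose (k - l) +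
      2 * ∑ t with l ≤ heightAt π t, (k - l + (k - 1 - π t)).choose (k - l) := by
  obtain ⟨hlk, hfix⟩ := (le_streak_iff π l).1 hl
  have ho : l - 1 < k := by omega
  let o : Fin k := ⟨l - 1, ho⟩
  have ho' : (o : ℕ) + 1 = l := by simp only [o]; omega
  have main := card_linkedPairs_univ π hm o ho'
  have hoc : #(attachedPairs π m o l) = (2 * (k - l)).choose (k - l) := by
    rw [card_attachedPairs_eq hm o hl1 ho'.ge hfix fun a b _ hab hb =>
      lt_of_le_streak π (Fin.lt_def.2 (by omega)) (by omega), hfix o (by omega)]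
    congr 1
    omega
  have hsum : ∑ t ∈ univ.erase o, #(attachedPairs π m t l) =
      ∑ t with l ≤ heightAt π t, (k - l + (k - 1 - π t)).choose (k - l) := by
    symm
    trans ∑ t with l ≤ heightAt π t, #(attachedPairs π m t l)
    · refine sum_congr rfl fun t ht => ?_
      obtain ⟨h1, h2⟩ := (le_heightAt_iff _ _ _).1 (mem_filter.1 ht).2
      exact (card_attachedPairs_eq hm t hl1 (by omega) hfix h2).symm
    · refine sum_subset (fun t ht => ?_) (fun t ht ht' => ?_)
      · have := ((le_heightAt_iff _ _ _).1 (mem_filter.1 ht).2).1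
        refine mem_erase.2 ⟨?_, mem_univ _⟩
        rintro rfl
        omega
      · have hne : (t : ℕ) + 1 ≠ l := fun h => (mem_erase.1 ht).1 (Fin.ext (by omega))
        rw [attachedPairs_eq_empty (by omega) hne (by simpa using ht'), card_empty]
  rw [← add_sum_erase _ _ (mem_univ o), hsum, hoc] at main
  omega

theorem Grounded.card_linkedPairs_le {m : ℕ} {π : Pattern k} (h : Grounded π)
    (hm : m + (streak π + 1) = 2 * k) :
    #(linkedPairs π (univ : Finset (Fin m))) ≤
      (2 * (k - (streak π + 1))).choose (k - (streak π + 1)) := by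
  let o : Fin k := ⟨streak π, h.streak_lt⟩
  have main := card_linkedPairs_univ π hm o rfl
  have hsum : ∑ t ∈ univ.erase o, #(attachedPairs π m t (streak π + 1)) = 0 := by
    refine sum_eq_zero fun t ht => ?_
    have hne : (t : ℕ) + 1 ≠ streak π + 1 := fun h =>
      (mem_erase.1 ht).1 (Fin.ext (by simp only [o]; omega))
    rw [attachedPairs_eq_empty le_rfl hne (by have := h.heightAt_le t; omega), card_empty]
  rw [← add_sum_erase _ _ (mem_univ o), hsum] at main
  have := card_attachedPairs_le π hm o rfl
  omega

theorem StrongCEquiv.streak_le {π π' : Pattern k} (hπ : Grounded π) (hπ' : Grounded π')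
    (h : StrongCEquiv π π') : streak π' ≤ streak π := by
  by_contra! hlt
  have hk := hπ'.streak_lt
  have h1 := hπ.card_linkedPairs_le (m := 2 * k - (streak π + 1)) (by omega)
  rw [h.card_linkedPairs_eq,
    card_linkedPairs_of_le_streak (l := streak π + 1) (by omega) (by omega) hlt] at h1
  have hpos : 0 < ∑ t with streak π + 1 ≤ heightAt π' t,
      (k - (streak π + 1) + (k - 1 - π' t)).choose (k - (streak π + 1)) := by
    refine sum_pos (fun t _ => Nat.choose_pos (Nat.le_add_right _ _))
      ⟨⟨streak π + 1, by omega⟩, mem_filter.2 ⟨mem_univ _, (le_heightAt_iff _ _ _).2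
        ⟨le_rfl, fun a b _ hab hb => ?_⟩⟩⟩
    exact lt_of_le_streak π' (Fin.lt_def.2 (by omega)) (by simp only at hb; omega)
  omega

theorem sum_range_choose_lt {d n : ℕ} (hn : n ≤ d) :
    ∑ j ∈ range n, (d + j).choose d < (d + n).choose d := by
  have h1 : ∀ n, ∑ j ∈ range n, (d + j).choose d = (d + n).choose (d + 1) := by
    intro n
    induction n with
    | zero => simp
    | succ n ih => rw [sum_range_succ, ih, ← add_assoc, Nat.choose_succ_succ, add_comm]
  rw [h1]
  have h2 := Nat.choose_succ_right_eq (d + n) d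
  rw [Nat.add_sub_cancel_left] at h2
  have h3 : 0 < (d + n).choose d := Nat.choose_pos (Nat.le_add_right _ _)
  nlinarith

/-- The binomial coefficients `(d + j).choose d` with `j ≤ d` have distinct subset sums. -/
theorem eq_of_sum_choose_eq {d N : ℕ} (hN : N ≤ d + 1) {S T : Finset ℕ} (hS : S ⊆ range N)
    (hT : T ⊆ range N)
    (h : ∑ j ∈ S, (d + j).choose d = ∑ j ∈ T, (d + j).choose d) : S = T := by
  induction N generalizing S T with
  | zero =>
    rw [range_zero, subset_empty] at hS hT
    rw [hS, hT]
  | succ N ih =>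
    have sub : ∀ S ⊆ range (N + 1), N ∉ S → S ⊆ range N := by
      intro S hS hN x hx
      have := mem_range.1 (hS hx)
      have : x ≠ N := fun h => hN (h ▸ hx)
      exact mem_range.2 (by omega)
    have apart : ∀ S ⊆ range (N + 1), ∀ T, N ∉ S → N ∈ T →
        ∑ j ∈ S, (d + j).choose d < ∑ j ∈ T, (d + j).choose d := by
      intro S hS T hNS hNT
      calc ∑ j ∈ S, (d + j).choose d ≤ ∑ j ∈ range N, (d + j).choose d :=
            sum_le_sum_of_subset (sub S hS hNS)
        _ < (d + N).choose d := sum_range_choose_lt (by omega)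
        _ ≤ ∑ j ∈ T, (d + j).choose d :=
            single_le_sum (f := fun j => (d + j).choose d) (fun _ _ => Nat.zero_le _) hNT
    by_cases h1 : N ∈ S <;> by_cases h2 : N ∈ T
    · rw [← insert_erase h1, ← insert_erase h2]
      congr 1
      refine ih (by omega) (sub _ ((erase_subset _ _).trans hS) (notMem_erase _ _))
        (sub _ ((erase_subset _ _).trans hT) (notMem_erase _ _)) ?_
      rw [← add_sum_erase _ _ h1, ← add_sum_erase _ _ h2] at h
      exact Nat.add_left_cancel h
    · exact absurd h (apart T hT S h2 h1).ne'
    · exact absurd h (apart S hS T h1 h2).ne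
    · exact ih (by omega) (sub S hS h1) (sub T hT h2) h

theorem StrongCEquiv.le_heightAt {π π' : Pattern k} (h : StrongCEquiv π π') {l : ℕ}
    (hl1 : 1 ≤ l) (hl : l ≤ streak π) (hl' : l ≤ streak π') {j : Fin k}
    (hj : l ≤ heightAt π (π.symm j)) : l ≤ heightAt π' (π'.symm j) := by
  have hlk := ((le_streak_iff π l).1 hl).1
  have hN := h.card_linkedPairs_eq (2 * k - l)
  rw [card_linkedPairs_of_le_streak (by omega) hl1 hl,
    card_linkedPairs_of_le_streak (by omega) hl1 hl'] at hN
  let J : Pattern k → Finset ℕ := fun σ =>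
    (univ.filter fun t => l ≤ heightAt σ t).image fun t => k - 1 - (σ t : ℕ)
  have sumJ : ∀ σ : Pattern k, ∑ t with l ≤ heightAt σ t, (k - l + (k - 1 - σ t)).choose (k - l) =
      ∑ j ∈ J σ, (k - l + j).choose (k - l) := by
    intro σ
    rw [sum_image]
    intro s _ t _ e
    apply σ.injective
    have h1 := (σ s).2
    have h2 := (σ t).2
    simp only at e
    exact Fin.ext (by omega)
  have subJ : ∀ σ : Pattern k, l ≤ streak σ → J σ ⊆ range (k - l + 1) := by
    intro σ hσ x hx
    obtain ⟨t, ht, rfl⟩ := mem_image.1 hx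
    have h1 := ((le_heightAt_iff _ _ _).1 (mem_filter.1 ht).2).1
    have h2 := le_of_fixes_lt ((le_streak_iff σ l).1 hσ).2 h1
    exact mem_range.2 (by omega)
  rw [sumJ π, sumJ π'] at hN
  have hJ : J π = J π' := eq_of_sum_choose_eq le_rfl (subJ π hl) (subJ π' hl') (by omega)
  have hmem : k - 1 - (j : ℕ) ∈ J π :=
    mem_image.2 ⟨π.symm j, mem_filter.2 ⟨mem_univ _, hj⟩, by simp⟩
  rw [hJ] at hmem
  obtain ⟨t, ht, e⟩ := mem_image.1 hmem
  have h1 := (π' t).2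
  have h2 := j.2
  have : π' t = j := Fin.ext (by omega)
  rw [← this, Equiv.symm_apply_apply]
  exact (mem_filter.1 ht).2

theorem StrongCEquiv.symm {π π' : Pattern k} (h : StrongCEquiv π π') : StrongCEquiv π' π :=
  fun m n => (h m n).symm

theorem StrongCEquiv.heightAt_le {π π' : Pattern k} (hπ : Grounded π) (h : StrongCEquiv π π')
    (hs : streak π = streak π') (j : Fin k) :
    heightAt π (π.symm j) ≤ heightAt π' (π'.symm j) := by
  rcases Nat.eq_zero_or_pos (heightAt π (π.symm j)) with h0 | h0
  · omega
  · exact h.le_heightAt h0 (hπ.heightAt_le _) (hs ▸ hπ.heightAt_le _) le_rfl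

end Heights

end

/-- Strongly c-forest-Wilf equivalent grounded patterns have the same streak, and each
value `i ∈ {2, …, k}` has the same height in both (the height of the value `j` is the
height of the entry at position `π⁻¹(j)`). -/
theorem strongCEquiv_grounded_same_streak_heights {k : ℕ} (π π' : Pattern k)
    (hπ : Grounded π) (hπ' : Grounded π') (h : StrongCEquiv π π') :
    streak π = streak π' ∧
    ∀ j : Fin k, 0 < (j : ℕ) → heightAt π (π.symm j) = heightAt π' (π'.symm j) := by
  have hs : streak π = streak π' :=
    le_antisymm (h.symm.streak_le hπ' hπ) (h.streak_le hπ hπ')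
  exact ⟨hs, fun j _ => le_antisymm (h.heightAt_le hπ hs j) (h.symm.heightAt_le hπ' hs.symm j)⟩
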